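/- Let L be a domain, let E be a topological space, and let ν be an L-valued maxitive measure on the Borel σ-algebra ℬ of E. Then ν is weakly inner-continuous if and only if, for every family 𝒪 of open subsets of E, the supremum of {ν(O) : O ∈ 𝒪} exists and equals ν(⋃𝒪). -/

import Mathlib

open Set

universe u v

section OrderDefs
variable {L : Type u} [PartialOrder L]

/-- A filtered (nonempty, downward directed) subset of a poset. -/
def DirFiltered (F : Set L) : Prop :=
  F.Nonempty ∧ ∀ r ∈ F, ∀ s ∈ F, ∃ t ∈ F, t ≤ r ∧ t ≤ s

/-- A filter of a poset: a filtered upper set. -/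
def OrdFilter (F : Set L) : Prop :=
  DirFiltered F ∧ ∀ r ∈ F, ∀ s : L, r ≤ s → s ∈ F

/-- Every filter has an infimum. -/
def FilteredComplete (L : Type u) [PartialOrder L] : Prop :=
  ∀ F : Set L, OrdFilter F → ∃ i : L, IsGLB F i

/-- `s` is way-above `r`: for every filter `F` with an infimum below `r`, `s ∈ F`. -/
def WayAbove (s r : L) : Prop :=
  ∀ F : Set L, OrdFilter F → ∀ i : L, IsGLB F i → i ≤ r → s ∈ F

/-- The poset is continuous: for every `r`, the set of elements way-above `r`
is a filter whose infimum is `r`. -/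
def ContinuousPoset (L : Type u) [PartialOrder L] : Prop :=
  ∀ r : L, OrdFilter {s : L | WayAbove s r} ∧ IsGLB {s : L | WayAbove s r} r

/-- Conditional completeness: every nonempty set bounded above has a supremum. -/
def CondComplete (L : Type u) [PartialOrder L] : Prop :=
  ∀ S : Set L, S.Nonempty → BddAbove S → ∃ m : L, IsLUB S m

end OrderDefs

/-- A domain: a filtered-complete continuous poset with a least element. -/
def DomainPoset (L : Type u) [PartialOrder L] [OrderBot L] : Prop :=
  FilteredComplete L ∧ ContinuousPoset L

section TopDefs
variable {E : Type v} [TopologicalSpace E]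

/-- The saturation of a set: intersection of all open sets containing it. -/
def satur (A : Set E) : Set E := ⋂₀ {G : Set E | IsOpen G ∧ A ⊆ G}

/-- A set is saturated if it is an intersection of open sets. -/
def IsSatur (A : Set E) : Prop :=
  ∃ 𝒢 : Set (Set E), (∀ G ∈ 𝒢, IsOpen G) ∧ A = ⋂₀ 𝒢

/-- The collection 𝒬 of compact saturated subsets. -/
def CompactSat (E : Type v) [TopologicalSpace E] : Set (Set E) :=
  {A : Set E | IsCompact A ∧ IsSatur A}

/-- The Borel σ-algebra generated by open sets and compact saturated sets. -/
def BorelM (E : Type v) [TopologicalSpace E] : MeasurableSpace E :=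
  MeasurableSpace.generateFrom ({A : Set E | IsOpen A} ∪ CompactSat E)

/-- Borel subsets for the σ-algebra generated by opens and compact saturated sets. -/
def IsBorelSet (B : Set E) : Prop := @MeasurableSet E (BorelM E) B

/-- The collection 𝒦 of compact Borel subsets. -/
def CompactBorel (E : Type v) [TopologicalSpace E] : Set (Set E) :=
  {A : Set E | IsBorelSet A ∧ IsCompact A}

/-- `[x]` : the compact Borel set `↑{x} ∩ closure {x}`. -/
def ptClass (x : E) : Set E := satur {x} ∩ closure {x}

end TopDefs

section MeasDefs
variable {L : Type u} {E : Type v} [PartialOrder L] [OrderBot L] [TopologicalSpace E]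

/-- An L-valued maxitive measure on the Borel σ-algebra. -/
def Maxitive (ν : Set E → L) : Prop :=
  ν ∅ = ⊥ ∧ ∀ 𝒞 : Set (Set E), 𝒞.Finite → (∀ B ∈ 𝒞, IsBorelSet B) →
    IsLUB (ν '' 𝒞) (ν (⋃₀ 𝒞))

/-- σ-maxitivity. -/
def SigmaMaxitive (ν : Set E → L) : Prop :=
  Maxitive ν ∧ ∀ 𝒞 : Set (Set E), 𝒞.Countable → (∀ B ∈ 𝒞, IsBorelSet B) →
    IsLUB (ν '' 𝒞) (ν (⋃₀ 𝒞))

/-- Complete maxitivity. -/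
def CompletelyMaxitive (ν : Set E → L) : Prop :=
  Maxitive ν ∧ ∀ 𝒞 : Set (Set E), (∀ B ∈ 𝒞, IsBorelSet B) → IsBorelSet (⋃₀ 𝒞) →
    IsLUB (ν '' 𝒞) (ν (⋃₀ 𝒞))

/-- The set `{ν G : G open, G ⊇ B}`. -/
def outerVals (ν : Set E → L) (B : Set E) : Set L :=
  {l : L | ∃ G : Set E, IsOpen G ∧ B ⊆ G ∧ ν G = l}

/-- `νp` is the map `ν⁺ : B ↦ inf {ν G : G open, G ⊇ B}` on Borel sets. -/
def IsNuPlus (ν νp : Set E → L) : Prop :=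
  ∀ B : Set E, IsBorelSet B → IsGLB (outerVals ν B) (νp B)

/-- Outer-continuity. -/
def OuterContinuous (ν : Set E → L) : Prop :=
  ∀ B : Set E, IsBorelSet B → IsGLB (outerVals ν B) (ν B)

/-- Inner-continuity. -/
def InnerContinuous (ν : Set E → L) : Prop :=
  ∀ B : Set E, IsBorelSet B →
    IsLUB {l : L | ∃ K : Set E, IsBorelSet K ∧ IsCompact K ∧ K ⊆ B ∧ ν (satur K) = l} (ν B)

/-- Regularity: inner- and outer-continuity. -/
def RegularMeasure (ν : Set E → L) : Prop :=
  InnerContinuous ν ∧ OuterContinuous ν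

/-- Weak outer-continuity: `ν K = ν⁺ K` for every compact Borel `K`. -/
def WeaklyOuterContinuous (ν : Set E → L) : Prop :=
  ∀ K : Set E, IsBorelSet K → IsCompact K → IsGLB (outerVals ν K) (ν K)

/-- Weak inner-continuity (relative to a given `ν⁺ = νp`). -/
def WeaklyInnerContinuous (ν νp : Set E → L) : Prop :=
  ∀ G : Set E, IsOpen G →
    IsLUB {l : L | ∃ K : Set E, IsBorelSet K ∧ IsCompact K ∧ K ⊆ G ∧ νp K = l} (ν G)

/-- 𝒜-smoothness. -/
def SmoothWrt (ν : Set E → L) (𝒜 : Set (Set E)) : Prop :=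
  ∀ 𝒟 : Set (Set E), 𝒟.Nonempty → 𝒟 ⊆ 𝒜 → DirectedOn (· ⊇ ·) 𝒟 →
    IsGLB (ν '' 𝒟) (ν (⋂₀ 𝒟))

/-- Saturation of a maxitive measure: `ν K = ν (↑K)` for compact Borel `K`. -/
def SaturatedMeasure (ν : Set E → L) : Prop :=
  ∀ K : Set E, IsBorelSet K → IsCompact K → ν K = ν (satur K)

/-- Tightness: `inf {ν (E ∖ K) : K compact Borel} = 0`. -/
def TightMeasure (ν : Set E → L) : Prop :=
  IsGLB {l : L | ∃ K : Set E, IsBorelSet K ∧ IsCompact K ∧ ν Kᶜ = l} (⊥ : L)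

/-- `c` is a cardinal density of `ν`. -/
def IsCardinalDensity (ν : Set E → L) (c : E → L) : Prop :=
  ∀ B : Set E, IsBorelSet B → IsLUB (c '' B) (ν B)

/-- Upper semicontinuity of a map into the poset. -/
def UscMap (c : E → L) : Prop := ∀ t : L, IsOpen {x : E | WayAbove t (c x)}

/-- Upper compactness of a map into the poset. -/
def UpperCompactMap (c : E → L) : Prop :=
  ∀ t : L, WayAbove t (⊥ : L) → IsCompact {x : E | ¬ WayAbove t (c x)}

/-- Continuity from above along decreasing sequences of Borel sets. -/
def ContinuousFromAbove (ν : Set E → L) : Prop :=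
  ∀ B : ℕ → Set E, (∀ n, IsBorelSet (B n)) → (∀ n, B (n + 1) ⊆ B n) →
    IsGLB (Set.range fun n => ν (B n)) (ν (⋂ n, B n))

/-- An optimal measure: a σ-maxitive measure continuous from above. -/
def OptimalMeasure (ν : Set E → L) : Prop :=
  SigmaMaxitive ν ∧ ContinuousFromAbove ν

/-- `flo` is the regular part `⌊ν⌋` (relative to `νp = ν⁺`):
`⌊ν⌋(B) = sup {ν⁺(K) : K compact Borel, K ⊆ B}`. -/
def RegPartRel (νp flo : Set E → L) : Prop :=
  ∀ B : Set E, IsBorelSet B →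
    IsLUB {l : L | ∃ K : Set E, IsBorelSet K ∧ IsCompact K ∧ K ⊆ B ∧ νp K = l} (flo B)

end MeasDefs

section BorelFacts
variable {E : Type v} [TopologicalSpace E]

theorem IsOpen.isBorelSet {G : Set E} (hG : IsOpen G) : IsBorelSet G :=
  MeasurableSpace.measurableSet_generateFrom (Or.inl hG)

theorem subset_satur (A : Set E) : A ⊆ satur A :=
  fun _ hx _ hG => hG.2 hx

theorem satur_subset {A G : Set E} (hG : IsOpen G) (h : A ⊆ G) : satur A ⊆ G :=
  sInter_subset_of_mem ⟨hG, h⟩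

theorem mem_ptClass (x : E) : x ∈ ptClass x :=
  ⟨subset_satur _ rfl, subset_closure rfl⟩

theorem ptClass_subset {x : E} {G : Set E} (hG : IsOpen G) (hx : x ∈ G) : ptClass x ⊆ G :=
  inter_subset_left.trans (satur_subset hG (singleton_subset_iff.2 hx))

/-- A set lying between `{x}` and its saturation is compact. -/
theorem isCompact_of_subset_satur_singleton {x : E} {A : Set E} (hx : x ∈ A)
    (hA : A ⊆ satur {x}) : IsCompact A := by
  refine isCompact_of_finite_subcover fun {ι} U hU hAU => ?_
  obtain ⟨i, hi⟩ := mem_iUnion.1 (hAU hx)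
  refine ⟨{i}, ?_⟩
  simpa using hA.trans (satur_subset (hU i) (singleton_subset_iff.2 hi))

theorem isCompact_ptClass (x : E) : IsCompact (ptClass x) :=
  isCompact_of_subset_satur_singleton (mem_ptClass x) inter_subset_left

theorem isBorelSet_ptClass (x : E) : IsBorelSet (ptClass x) := by
  have h₁ : IsBorelSet (satur {x}) :=
    MeasurableSpace.measurableSet_generateFrom <| Or.inr
      ⟨isCompact_of_subset_satur_singleton (subset_satur _ rfl) Subset.rfl,
        {G : Set E | IsOpen G ∧ {x} ⊆ G}, fun _ hG => hG.1, rfl⟩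
  have h₂ : IsBorelSet (closure {x}) := by
    have h := (IsOpen.isBorelSet (isClosed_closure (s := {x})).isOpen_compl).compl
    rwa [compl_compl] at h
  exact MeasurableSet.inter h₁ h₂

end BorelFacts

section MaxitiveFacts
variable {L : Type u} {E : Type v} [PartialOrder L] [OrderBot L] [TopologicalSpace E]

theorem Maxitive.mono {ν : Set E → L} (hν : Maxitive ν) {A B : Set E}
    (hA : IsBorelSet A) (hB : IsBorelSet B) (h : A ⊆ B) : ν A ≤ ν B := by
  have hlub := hν.2 {A, B} (by simp) (by rintro C (rfl | rfl) <;> assumption)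
  rw [sUnion_pair, union_eq_self_of_subset_left h] at hlub
  exact hlub.1 ⟨A, by simp, rfl⟩

theorem Maxitive.mono_of_isOpen {ν : Set E → L} (hν : Maxitive ν) {G H : Set E}
    (hG : IsOpen G) (hH : IsOpen H) (h : G ⊆ H) : ν G ≤ ν H :=
  hν.mono hG.isBorelSet hH.isBorelSet h

/-- An element way-above an upper bound of `ν⁺(B)` dominates `ν` on an open
neighbourhood of `B`. -/
theorem WayAbove.exists_isOpen_le {ν : Set E → L} (hν : Maxitive ν) {B : Set E} {i s r : L}
    (hi : IsGLB (outerVals ν B) i) (hir : i ≤ r) (hs : WayAbove s r) :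
    ∃ G : Set E, IsOpen G ∧ B ⊆ G ∧ ν G ≤ s := by
  refine hs {l | ∃ G : Set E, IsOpen G ∧ B ⊆ G ∧ ν G ≤ l} ⟨⟨?_, ?_⟩, ?_⟩ i ⟨?_, ?_⟩ hir
  · exact ⟨_, univ, isOpen_univ, subset_univ _, le_rfl⟩
  · rintro a ⟨G, hG, hBG, ha⟩ b ⟨H, hH, hBH, hb⟩
    exact ⟨ν (G ∩ H), ⟨_, hG.inter hH, subset_inter hBG hBH, le_rfl⟩,
      (hν.mono_of_isOpen (hG.inter hH) hG inter_subset_left).trans ha,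
      (hν.mono_of_isOpen (hG.inter hH) hH inter_subset_right).trans hb⟩
  · rintro a ⟨G, hG, hBG, ha⟩ b hab
    exact ⟨G, hG, hBG, ha.trans hab⟩
  · rintro a ⟨G, hG, hBG, ha⟩
    exact (hi.1 ⟨G, hG, hBG, rfl⟩).trans ha
  · rintro a ha
    refine hi.2 ?_
    rintro _ ⟨G, hG, hBG, rfl⟩
    exact ha ⟨G, hG, hBG, le_rfl⟩

end MaxitiveFacts

/-- ν is weakly inner-continuous iff for every family 𝒪 of open
sets, sup {ν O : O ∈ 𝒪} exists and equals ν(⋃𝒪). -/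
theorem stmt15 {L : Type u} {E : Type v} [PartialOrder L] [OrderBot L]
    [TopologicalSpace E] (hL : DomainPoset L)
    (ν νp : Set E → L) (hν : Maxitive ν) (hνp : IsNuPlus ν νp) :
    WeaklyInnerContinuous ν νp ↔
      ∀ 𝒪 : Set (Set E), (∀ O ∈ 𝒪, IsOpen O) → IsLUB (ν '' 𝒪) (ν (⋃₀ 𝒪)) := by
  constructor
  · refine fun h 𝒪 h𝒪 => ⟨?_, fun u hu => (h _ (isOpen_sUnion h𝒪)).2 ?_⟩
    · rintro _ ⟨O, hO, rfl⟩
      exact hν.mono_of_isOpen (h𝒪 O hO) (isOpen_sUnion h𝒪) (subset_sUnion_of_mem hO)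
    · rintro _ ⟨K, hKB, hK, hKG, rfl⟩
      obtain ⟨T, hT, hTf, hKT⟩ := hK.elim_finite_subcover_image h𝒪 (hKG.trans sUnion_eq_biUnion.subset)
      have hTo : ∀ O ∈ T, IsOpen O := fun O hO => h𝒪 O (hT hO)
      exact ((hνp K hKB).1 ⟨_, isOpen_sUnion hTo, hKT.trans sUnion_eq_biUnion.superset, rfl⟩).trans <|
        (hν.2 T hTf fun O hO => (hTo O hO).isBorelSet).2
          (upperBounds_mono_set (image_mono hT) hu)
  · refine fun h G hG => ⟨?_, fun u hu => (hL.2 u).2.2 fun s hs => ?_⟩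
    · rintro _ ⟨K, hKB, -, hKG, rfl⟩
      exact (hνp K hKB).1 ⟨G, hG, hKG, rfl⟩
    · have hcover : ⋃₀ {O : Set E | IsOpen O ∧ O ⊆ G ∧ ν O ≤ s} = G := by
        refine Subset.antisymm (sUnion_subset fun O hO => hO.2.1) fun x hx => ?_
        obtain ⟨H, hH, hxH, hHs⟩ := WayAbove.exists_isOpen_le hν
          (hνp _ (isBorelSet_ptClass x))
          (hu ⟨_, isBorelSet_ptClass x, isCompact_ptClass x, ptClass_subset hG hx, rfl⟩) hs
        exact ⟨H ∩ G, ⟨hH.inter hG, inter_subset_right,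
          (hν.mono_of_isOpen (hH.inter hG) hH inter_subset_left).trans hHs⟩,
          hxH (mem_ptClass x), hx⟩
      have hlub := h {O : Set E | IsOpen O ∧ O ⊆ G ∧ ν O ≤ s} fun O hO => hO.1
      rw [hcover] at hlub
      refine hlub.2 ?_
      rintro _ ⟨O, hO, rfl⟩
      exact hO.2.2
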